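/- Let (E, {f_i}_{i=1}^m) ∈ 𝓔 with convex hull I. If f_1(I) ∩ f_2(I) = ∅ and f_{m−1}(I) ∩ f_m(I) = ∅, then U_k(E) = ∅ for every integer k ≥ 1 that is not of the form 2^s for an integer s ≥ 0. -/

import Mathlib

open Set Filter MeasureTheory

/-- A self-similar iterated function system on `ℝ` given by `m` similitudes
`f i x = r i * x + t i` (for `1 ≤ i ≤ m`, `m ≥ 3`), together with its attractor `E`:
the unique nonempty compact set with `E = ⋃_{i=1}^m f_i(E)`. -/
structure ClassE where
  m : ℕ
  r : ℕ → ℝ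
  t : ℕ → ℝ
  E : Set ℝ
  hm : 3 ≤ m
  hr : ∀ i, 1 ≤ i → i ≤ m → 0 < r i ∧ r i < 1
  hEne : E.Nonempty
  hEcpt : IsCompact E
  hEinv : E = ⋃ i ∈ Finset.Icc 1 m, (fun x => r i * x + t i) '' E

namespace ClassE

/-- The `i`-th similitude. -/
def f (S : ClassE) (i : ℕ) (x : ℝ) : ℝ := S.r i * x + S.t i

/-- Left endpoint `a` of the convex hull of `E`. -/
noncomputable def a (S : ClassE) : ℝ := sInf S.E

/-- Right endpoint `b` of the convex hull of `E`. -/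
noncomputable def b (S : ClassE) : ℝ := sSup S.E

/-- The convex hull `I = [a, b]` of `E`. -/
noncomputable def I (S : ClassE) : Set ℝ := Set.Icc S.a S.b

/-- Condition (A): `a = f_1(a) < f_2(a) < ⋯ < f_m(a) < f_m(b) = b`. -/
def condA (S : ClassE) : Prop :=
  S.f 1 S.a = S.a ∧ (∀ i, 1 ≤ i → i < S.m → S.f i S.a < S.f (i + 1) S.a) ∧
    S.f S.m S.a < S.f S.m S.b ∧ S.f S.m S.b = S.b

/-- Condition (B): `f_i(I) ∩ f_{i+2}(I) = ∅` for all `1 ≤ i ≤ m - 2`. -/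
def condB (S : ClassE) : Prop :=
  ∀ i, 1 ≤ i → i + 2 ≤ S.m → S.f i '' S.I ∩ S.f (i + 2) '' S.I = ∅

/-- Condition (C): there are `i, j ∈ {1, …, m-1}` with `f_i(I) ∩ f_{i+1}(I) = ∅` and
`f_j(I) ∩ f_{j+1}(I) ≠ ∅`. -/
def condC (S : ClassE) : Prop :=
  (∃ i, 1 ≤ i ∧ i + 1 ≤ S.m ∧ S.f i '' S.I ∩ S.f (i + 1) '' S.I = ∅) ∧
    (∃ j, 1 ≤ j ∧ j + 1 ≤ S.m ∧ S.f j '' S.I ∩ S.f (j + 1) '' S.I ≠ ∅)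

/-- Condition (D): whenever `f_i(I) ∩ f_{i+1}(I) ≠ ∅` there are `u, v ≥ 1` with
`f_i(I) ∩ f_{i+1}(I) = f_i ∘ f_m^u (I) = f_{i+1} ∘ f_1^v (I)`. -/
def condD (S : ClassE) : Prop :=
  ∀ i, 1 ≤ i → i + 1 ≤ S.m → S.f i '' S.I ∩ S.f (i + 1) '' S.I ≠ ∅ →
    ∃ u v : ℕ, 1 ≤ u ∧ 1 ≤ v ∧
      S.f i '' S.I ∩ S.f (i + 1) '' S.I = (S.f i ∘ (S.f S.m)^[u]) '' S.I ∧
      S.f i '' S.I ∩ S.f (i + 1) '' S.I = (S.f (i + 1) ∘ (S.f 1)^[v]) '' S.I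

/-- Membership in the class `𝓔`: conditions (A)–(D). -/
def goodE (S : ClassE) : Prop := S.condA ∧ S.condB ∧ S.condC ∧ S.condD

/-- `prefixMap d n = f_{d 0} ∘ f_{d 1} ∘ ⋯ ∘ f_{d (n-1)}`. -/
def prefixMap (S : ClassE) (d : ℕ → ℕ) : ℕ → ℝ → ℝ
  | 0 => id
  | n + 1 => S.prefixMap d n ∘ S.f (d n)

/-- `d : ℕ → ℕ` (with digits in `{1, …, m}`) is a coding of `x` if
`x = lim_n f_{d 0} ∘ ⋯ ∘ f_{d (n-1)} (0)`. -/
def isCoding (S : ClassE) (d : ℕ → ℕ) (x : ℝ) : Prop :=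
  (∀ n, 1 ≤ d n ∧ d n ≤ S.m) ∧
    Tendsto (fun n => S.prefixMap d n 0) atTop (nhds x)

/-- The set of codings of `x`. -/
def codings (S : ClassE) (x : ℝ) : Set (ℕ → ℕ) := {d | S.isCoding d x}

/-- `U k E`: the set of points of `E` having exactly `k` distinct codings
(`k` a cardinal; e.g. `k = ℵ₀` for countably infinitely many codings,
`k = 𝔠 = 2^ℵ₀` for a continuum of codings). -/
def U (S : ClassE) (k : Cardinal) : Set ℝ :=
  {x ∈ S.E | Cardinal.mk (S.codings x) = k}

end ClassE

namespace ClassE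

def consC (i : ℕ) (d : ℕ → ℕ) : ℕ → ℕ
  | 0 => i
  | n + 1 => d n

lemma consC_inj (i : ℕ) : Function.Injective (consC i) := by
  intro d e h
  funext n
  exact congrFun h (n + 1)

lemma consC_eta (d : ℕ → ℕ) : consC (d 0) (fun n => d (n + 1)) = d := by
  funext n
  cases n <;> rfl

lemma prefixMap_cons (S : ClassE) (i : ℕ) (d : ℕ → ℕ) (n : ℕ) (x : ℝ) :
    S.prefixMap (consC i d) (n + 1) x = S.f i (S.prefixMap d n x) := by
  induction n generalizing x with
  | zero => simp [prefixMap, consC]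
  | succ n ih =>
    rw [prefixMap, Function.comp, ih]
    rfl

lemma f_mono (S : ClassE) {i : ℕ} (h1 : 1 ≤ i) (h2 : i ≤ S.m) : StrictMono (S.f i) := by
  intro x y h
  have := (S.hr i h1 h2).1
  simp only [f]
  nlinarith

lemma f_cont (S : ClassE) (i : ℕ) : Continuous (S.f i) := by
  unfold f
  fun_prop

lemma isCoding_cons (S : ClassE) {i : ℕ} (h1 : 1 ≤ i) (h2 : i ≤ S.m) (d : ℕ → ℕ) (y : ℝ) :
    S.isCoding (consC i d) (S.f i y) ↔ S.isCoding d y := by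
  have hr := (S.hr i h1 h2).1
  constructor
  · rintro ⟨hd, ht⟩
    refine ⟨fun n => hd (n + 1), ?_⟩
    have h3 := (tendsto_add_atTop_iff_nat 1).2 ht
    simp only [prefixMap_cons] at h3
    have hc : Continuous (fun z => (z - S.t i) / S.r i) := by fun_prop
    have h4 := (hc.tendsto _).comp h3
    have e : ∀ z, (S.f i z - S.t i) / S.r i = z := by
      intro z; unfold f; field_simp; ring
    simpa [Function.comp_def, e] using h4
  · rintro ⟨hd, ht⟩
    refine ⟨fun n => ?_, ?_⟩
    · cases n with
      | zero => exact ⟨h1, h2⟩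
      | succ n => exact hd n
    · rw [← tendsto_add_atTop_iff_nat 1]
      simp only [prefixMap_cons]
      exact ((S.f_cont i).tendsto _).comp ht

lemma a_mem (S : ClassE) : S.a ∈ S.E := S.hEcpt.sInf_mem S.hEne
lemma b_mem (S : ClassE) : S.b ∈ S.E := S.hEcpt.sSup_mem S.hEne

lemma E_sub (S : ClassE) : S.E ⊆ S.I := fun _ hx =>
  ⟨csInf_le S.hEcpt.bddBelow hx, le_csSup S.hEcpt.bddAbove hx⟩

lemma f_E (S : ClassE) {i : ℕ} (h1 : 1 ≤ i) (h2 : i ≤ S.m) {x : ℝ} (hx : x ∈ S.E) :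
    S.f i x ∈ S.E := by
  rw [S.hEinv]
  simp only [mem_iUnion]
  exact ⟨i, Finset.mem_Icc.2 ⟨h1, h2⟩, x, hx, rfl⟩

lemma prefix_E (S : ClassE) (d : ℕ → ℕ) (hd : ∀ n, 1 ≤ d n ∧ d n ≤ S.m) (n : ℕ) {x : ℝ}
    (hx : x ∈ S.E) : S.prefixMap d n x ∈ S.E := by
  induction n generalizing x with
  | zero => exact hx
  | succ n ih => exact ih (S.f_E (hd n).1 (hd n).2 hx)

lemma exists_R (S : ClassE) : ∃ R : ℝ, 0 ≤ R ∧ R < 1 ∧ ∀ i, 1 ≤ i → i ≤ S.m → S.r i ≤ R := by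
  have hm := S.hm
  have hne : (Finset.Icc 1 S.m).Nonempty := ⟨1, Finset.mem_Icc.2 ⟨le_rfl, by omega⟩⟩
  obtain ⟨j, hj, hmax⟩ := Finset.exists_max_image _ S.r hne
  rw [Finset.mem_Icc] at hj
  refine ⟨S.r j, (S.hr j hj.1 hj.2).1.le, (S.hr j hj.1 hj.2).2, fun i h1 h2 => ?_⟩
  exact hmax i (Finset.mem_Icc.2 ⟨h1, h2⟩)

lemma prefix_contract (S : ClassE) (d : ℕ → ℕ) (hd : ∀ n, 1 ≤ d n ∧ d n ≤ S.m) {R : ℝ}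
    (hR0 : 0 ≤ R) (hR : ∀ i, 1 ≤ i → i ≤ S.m → S.r i ≤ R) (n : ℕ) (x y : ℝ) :
    |S.prefixMap d n x - S.prefixMap d n y| ≤ R ^ n * |x - y| := by
  induction n generalizing x y with
  | zero => simp [prefixMap]
  | succ n ih =>
    have h := ih (S.f (d n) x) (S.f (d n) y)
    have e : S.f (d n) x - S.f (d n) y = S.r (d n) * (x - y) := by unfold f; ring
    rw [e, abs_mul, abs_of_pos (S.hr _ (hd n).1 (hd n).2).1] at h
    have h3 := hR _ (hd n).1 (hd n).2
    calc _ ≤ _ := h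
      _ ≤ R ^ n * (R * |x - y|) := by gcongr
      _ = _ := by ring

lemma coding_mem_I (S : ClassE) {d : ℕ → ℕ} {x : ℝ} (h : S.isCoding d x) : x ∈ S.I := by
  obtain ⟨hd, ht⟩ := h
  obtain ⟨R, hR0, hR1, hR⟩ := S.exists_R
  have h1 : Tendsto (fun n => R ^ n * |S.a - 0|) atTop (nhds 0) := by
    simpa using (tendsto_pow_atTop_nhds_zero_of_lt_one hR0 hR1).mul_const (|S.a - 0|)
  have h2 : Tendsto (fun n => S.prefixMap d n S.a - S.prefixMap d n 0) atTop (nhds 0) :=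
    squeeze_zero_norm (fun n => S.prefix_contract d hd hR0 hR n S.a 0) h1
  have h3 : Tendsto (fun n => S.prefixMap d n S.a) atTop (nhds x) := by
    simpa using h2.add ht
  exact isClosed_Icc.mem_of_tendsto h3
    (Eventually.of_forall fun n => S.E_sub (S.prefix_E d hd n S.a_mem))

lemma coding_head (S : ClassE) {d : ℕ → ℕ} {x : ℝ} (h : S.isCoding d x) :
    ∃ y ∈ S.I, x = S.f (d 0) y ∧ S.isCoding (fun n => d (n + 1)) y := by
  have hd := h.1 0
  have hr := (S.hr _ hd.1 hd.2).1
  have e : x = S.f (d 0) ((x - S.t (d 0)) / S.r (d 0)) := by unfold f; field_simp; ring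
  have h' : S.isCoding (fun n => d (n + 1)) ((x - S.t (d 0)) / S.r (d 0)) := by
    rw [← S.isCoding_cons hd.1 hd.2, ← e, consC_eta]
    exact h
  exact ⟨_, S.coding_mem_I h', e, h'⟩

lemma encard_of_head (S : ClassE) {i : ℕ} (h1 : 1 ≤ i) (h2 : i ≤ S.m) {y : ℝ}
    (h : ∀ d ∈ S.codings (S.f i y), d 0 = i) :
    (S.codings (S.f i y)).encard = (S.codings y).encard := by
  rw [← (consC_inj i).encard_image (S.codings y)]
  congr 1
  ext d
  constructor
  · intro hd
    have e := consC_eta d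
    rw [h d hd] at e
    refine ⟨_, ?_, e⟩
    have hd' : S.isCoding d (S.f i y) := hd
    rw [← e, S.isCoding_cons h1 h2] at hd'
    exact hd'
  · rintro ⟨e, he, rfl⟩
    exact (S.isCoding_cons h1 h2 e y).2 he

lemma encard_of_two (S : ClassE) {i j : ℕ} (hij : i ≠ j) (h1 : 1 ≤ i) (h2 : i ≤ S.m)
    (h3 : 1 ≤ j) (h4 : j ≤ S.m) {y z : ℝ} (hyz : S.f i y = S.f j z)
    (h : ∀ d ∈ S.codings (S.f i y), d 0 = i ∨ d 0 = j) :
    (S.codings (S.f i y)).encard = (S.codings y).encard + (S.codings z).encard := by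
  rw [← (consC_inj i).encard_image (S.codings y), ← (consC_inj j).encard_image (S.codings z),
    ← encard_union_eq]
  · congr 1
    ext d
    constructor
    · intro hd
      have hd' : S.isCoding d (S.f i y) := hd
      have e := consC_eta d
      rcases h d hd with h0 | h0
      · left
        rw [h0] at e
        refine ⟨_, ?_, e⟩
        rw [← e, S.isCoding_cons h1 h2] at hd'
        exact hd'
      · right
        rw [h0] at e
        refine ⟨_, ?_, e⟩
        rw [← e, hyz, S.isCoding_cons h3 h4] at hd'
        exact hd'
    · rintro (⟨e, he, rfl⟩ | ⟨e, he, rfl⟩)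
      · exact (S.isCoding_cons h1 h2 e y).2 he
      · rw [hyz]
        exact (S.isCoding_cons h3 h4 e z).2 he
  · rw [Set.disjoint_left]
    rintro _ ⟨e, -, rfl⟩ ⟨e', -, h'⟩
    exact hij (congrFun h' 0).symm

lemma fa_mono (S : ClassE) (hA : S.condA) {i j : ℕ} (h1 : 1 ≤ i) (hij : i ≤ j) (hj : j ≤ S.m) :
    S.f i S.a ≤ S.f j S.a := by
  induction j, hij using Nat.le_induction with
  | base => exact le_rfl
  | succ k hk ih => exact (ih (by omega)).trans (hA.2.1 k (by omega) (by omega)).le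

lemma a_lt_b (S : ClassE) (hA : S.condA) : S.a < S.b := by
  have hm := S.hm
  exact (S.f_mono (by omega) le_rfl).lt_iff_lt.1 hA.2.2.1

lemma disj_far (S : ClassE) (hA : S.condA) (hB : S.condB) {i j : ℕ} (h1 : 1 ≤ i)
    (hij : i + 2 ≤ j) (hj : j ≤ S.m) {y z : ℝ} (hy : y ∈ S.I) (hz : z ∈ S.I) :
    S.f i y ≠ S.f j z := by
  have hab := (S.a_lt_b hA).le
  have key : S.f i S.b < S.f (i + 2) S.a := by
    by_contra hcon
    push Not at hcon
    have hlt : S.f i S.a ≤ S.f (i + 2) S.a := S.fa_mono hA h1 (by omega) (by omega)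
    have hmem : S.f (i + 2) S.a ∈ S.f i '' S.I := by
      have := intermediate_value_Icc hab (S.f_cont i).continuousOn
      exact this ⟨hlt, hcon⟩
    have : S.f (i + 2) S.a ∈ S.f i '' S.I ∩ S.f (i + 2) '' S.I :=
      ⟨hmem, S.a, ⟨le_rfl, hab⟩, rfl⟩
    rw [hB i h1 (by omega)] at this
    exact this
  have k1 : S.f i y ≤ S.f i S.b := (S.f_mono h1 (by omega)).monotone hy.2
  have k2 : S.f j S.a ≤ S.f j z := (S.f_mono (by omega) hj).monotone hz.1
  have k3 : S.f (i + 2) S.a ≤ S.f j S.a := S.fa_mono hA (by omega) hij hj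
  linarith

lemma near (S : ClassE) (hA : S.condA) (hB : S.condB) {i j : ℕ} (h1 : 1 ≤ i) (hi : i ≤ S.m)
    (h1j : 1 ≤ j) (hj : j ≤ S.m) {y z : ℝ} (hy : y ∈ S.I) (hz : z ∈ S.I)
    (h : S.f i y = S.f j z) : i ≤ j + 1 ∧ j ≤ i + 1 := by
  constructor
  · by_contra hc
    exact S.disj_far hA hB h1j (by omega) hi hz hy h.symm
  · by_contra hc
    exact S.disj_far hA hB h1 (by omega) hj hy hz h

lemma f_I (S : ClassE) {i : ℕ} (h1 : 1 ≤ i) (h2 : i ≤ S.m) {x : ℝ} (hx : x ∈ S.I) :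
    S.f i x ∈ S.I :=
  ⟨(S.E_sub (S.f_E h1 h2 S.a_mem)).1.trans ((S.f_mono h1 h2).monotone hx.1),
    ((S.f_mono h1 h2).monotone hx.2).trans (S.E_sub (S.f_E h1 h2 S.b_mem)).2⟩

lemma encard_iter (S : ClassE) {i : ℕ} (h1 : 1 ≤ i) (h2 : i ≤ S.m)
    (h : ∀ y ∈ S.I, ∀ d ∈ S.codings (S.f i y), d 0 = i) (u : ℕ) {w : ℝ} (hw : w ∈ S.I) :
    (S.codings ((S.f i)^[u] w)).encard = (S.codings w).encard := by
  induction u generalizing w with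
  | zero => rfl
  | succ u ih =>
    rw [Function.iterate_succ_apply, ih (S.f_I h1 h2 hw), S.encard_of_head h1 h2 (h w hw)]

lemma iter_affine (S : ClassE) {i : ℕ} (h1 : 1 ≤ i) (h2 : i ≤ S.m) (u : ℕ) :
    ∃ p q : ℝ, 0 < p ∧ ∀ x, (S.f i)^[u] x = p * x + q := by
  induction u with
  | zero => exact ⟨1, 0, one_pos, fun x => by simp⟩
  | succ u ih =>
    obtain ⟨p, q, hp, h⟩ := ih
    refine ⟨S.r i * p, S.r i * q + S.t i, mul_pos (S.hr i h1 h2).1 hp, fun x => ?_⟩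
    rw [Function.iterate_succ_apply', h, f]
    ring

lemma comp_affine (S : ClassE) {i j : ℕ} (h1 : 1 ≤ i) (h2 : i ≤ S.m) (h3 : 1 ≤ j) (h4 : j ≤ S.m)
    (u : ℕ) : ∃ p q : ℝ, 0 < p ∧ S.f j ∘ (S.f i)^[u] = fun x => p * x + q := by
  obtain ⟨p, q, hp, h⟩ := S.iter_affine h1 h2 u
  refine ⟨S.r j * p, S.r j * q + S.t j, mul_pos (S.hr j h3 h4).1 hp, ?_⟩
  funext x
  rw [Function.comp, h, f]
  ring

lemma affine_eq {a b p q p' q' : ℝ} (hab : a < b) (hp : 0 < p) (hp' : 0 < p')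
    (h : (fun x => p * x + q) '' Icc a b = (fun x => p' * x + q') '' Icc a b) :
    p = p' ∧ q = q' := by
  rw [image_affine_Icc' hp, image_affine_Icc' hp', Icc_eq_Icc_iff (by nlinarith)] at h
  obtain ⟨h1, h2⟩ := h
  have : (p - p') * (b - a) = 0 := by linarith
  rcases mul_eq_zero.1 this with h | h
  · have : p = p' := by linarith
    subst this
    exact ⟨rfl, by linarith⟩
  · linarith

lemma head_m (S : ClassE) (hA : S.condA) (hB : S.condB)
    (h2 : S.f (S.m - 1) '' S.I ∩ S.f S.m '' S.I = ∅) :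
    ∀ y ∈ S.I, ∀ d ∈ S.codings (S.f S.m y), d 0 = S.m := by
  intro y hy d hd
  have hm := S.hm
  obtain ⟨z, hz, e, -⟩ := S.coding_head hd
  have hd0 := hd.1 0
  have hn := S.near hA hB (by omega) le_rfl hd0.1 hd0.2 hy hz e
  by_contra hc
  have h0 : d 0 = S.m - 1 := by omega
  have : S.f S.m y ∈ S.f (S.m - 1) '' S.I ∩ S.f S.m '' S.I :=
    ⟨⟨z, hz, by rw [e, h0]⟩, y, hy, rfl⟩
  rw [h2] at this
  exact this

lemma head_1 (S : ClassE) (hA : S.condA) (hB : S.condB)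
    (h1 : S.f 1 '' S.I ∩ S.f 2 '' S.I = ∅) :
    ∀ y ∈ S.I, ∀ d ∈ S.codings (S.f 1 y), d 0 = 1 := by
  intro y hy d hd
  have hm := S.hm
  obtain ⟨z, hz, e, -⟩ := S.coding_head hd
  have hd0 := hd.1 0
  have hn := S.near hA hB le_rfl (by omega) hd0.1 hd0.2 hy hz e
  by_contra hc
  have h0 : d 0 = 2 := by omega
  have : S.f 1 y ∈ S.f 1 '' S.I ∩ S.f 2 '' S.I :=
    ⟨⟨y, hy, rfl⟩, z, hz, by rw [e, h0]⟩
  rw [h1] at this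
  exact this

lemma branch (S : ClassE) (hS : S.goodE)
    (h1 : S.f 1 '' S.I ∩ S.f 2 '' S.I = ∅)
    (h2 : S.f (S.m - 1) '' S.I ∩ S.f S.m '' S.I = ∅) {i : ℕ} (hi : 1 ≤ i) (hi' : i + 1 ≤ S.m)
    {y z : ℝ} (hy : y ∈ S.I) (hz : z ∈ S.I) (hyz : S.f i y = S.f (i + 1) z) :
    ∃ w, (S.codings (S.f i y)).encard = (S.codings w).encard + (S.codings w).encard := by
  obtain ⟨hA, hB, hC, hD⟩ := hS
  have hm := S.hm
  have hmem : S.f i y ∈ S.f i '' S.I ∩ S.f (i + 1) '' S.I := ⟨⟨y, hy, rfl⟩, z, hz, hyz.symm⟩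
  obtain ⟨u, v, -, -, e1, e2⟩ := hD i hi hi' (Set.nonempty_iff_ne_empty.1 ⟨_, hmem⟩)
  have hmaps : S.f i ∘ (S.f S.m)^[u] = S.f (i + 1) ∘ (S.f 1)^[v] := by
    obtain ⟨p, q, hp, e⟩ := S.comp_affine (i := S.m) (j := i) (by omega) le_rfl hi (by omega) u
    obtain ⟨p', q', hp', e'⟩ :=
      S.comp_affine (i := 1) (j := i + 1) le_rfl (by omega) (by omega) hi' v
    have := e1.symm.trans e2
    rw [e, e'] at this
    obtain ⟨rfl, rfl⟩ := affine_eq (S.a_lt_b hA) hp hp' this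
    rw [e, e']
  have hmem' := hmem
  rw [e1] at hmem'
  obtain ⟨w, hw, hwe⟩ := hmem'
  have hwe2 : S.f (i + 1) ((S.f 1)^[v] w) = S.f i y := by
    rw [← hwe, hmaps]; rfl
  have hy' : (S.f S.m)^[u] w = y := (S.f_mono hi (by omega)).injective hwe
  have hz' : (S.f 1)^[v] w = z :=
    (S.f_mono (by omega) hi').injective (hwe2.trans hyz)
  refine ⟨w, ?_⟩
  rw [S.encard_of_two (i := i) (j := i + 1) (by omega) hi (by omega) (by omega) hi' hyz]
  · rw [← hy', ← hz', S.encard_iter (by omega) le_rfl (S.head_m hA hB h2) u hw,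
      S.encard_iter le_rfl (by omega) (S.head_1 hA hB h1) v hw]
  · intro d hd
    obtain ⟨x, hx, e, -⟩ := S.coding_head hd
    have hd0 := hd.1 0
    have n1 := S.near hA hB hi (by omega) hd0.1 hd0.2 hy hx e
    have n2 := S.near hA hB (by omega) hi' hd0.1 hd0.2 hz hx (hyz.symm.trans e)
    omega

lemma main (S : ClassE) (hS : S.goodE)
    (h1 : S.f 1 '' S.I ∩ S.f 2 '' S.I = ∅)
    (h2 : S.f (S.m - 1) '' S.I ∩ S.f S.m '' S.I = ∅) (k : ℕ) (hk : 1 ≤ k) (x : ℝ)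
    (hx : (S.codings x).encard = k) : ∃ s : ℕ, k = 2 ^ s := by
  induction k using Nat.strong_induction_on generalizing x with
  | _ k IH =>
  rcases hk.eq_or_lt with rfl | hk2
  · exact ⟨0, rfl⟩
  have hlt : 1 < (S.codings x).encard := by rw [hx]; exact_mod_cast hk2
  obtain ⟨d, d', hd, hd', hne⟩ := Set.one_lt_encard_iff.1 hlt
  obtain ⟨n, hn⟩ := Function.ne_iff.1 hne
  clear hne hlt
  induction n using Nat.strong_induction_on generalizing x d d' with
  | _ n ih =>
  -- is there a branching at the first digit?
  have step : ∀ i y z, 1 ≤ i → i + 1 ≤ S.m → y ∈ S.I → z ∈ S.I → x = S.f i y →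
      x = S.f (i + 1) z → ∃ s : ℕ, k = 2 ^ s := by
    intro i y z hi hi' hy hz e1 e2
    obtain ⟨w, hw⟩ := S.branch hS h1 h2 hi hi' hy hz (e1.symm.trans e2)
    rw [← e1, hx] at hw
    have hfin : (S.codings w).encard ≠ ⊤ := by
      intro h
      rw [h] at hw
      simp at hw
    obtain ⟨l, hl⟩ := ENat.ne_top_iff_exists.1 hfin
    rw [← hl] at hw
    have hkl : k = l + l := by exact_mod_cast hw
    obtain ⟨s, hs⟩ := IH l (by omega) (by omega) w hl.symm
    exact ⟨s + 1, by rw [pow_succ]; omega⟩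
  have gen : ∀ e ∈ S.codings x, ∀ e' ∈ S.codings x, e 0 < e' 0 → ∃ s : ℕ, k = 2 ^ s := by
    intro e he e' he' hlt
    obtain ⟨y, hy, ey, -⟩ := S.coding_head he
    obtain ⟨z, hz, ez, -⟩ := S.coding_head he'
    have h0 := he.1 0
    have h0' := he'.1 0
    have hnear := S.near hS.1 hS.2.1 h0.1 h0.2 h0'.1 h0'.2 hy hz (ey.symm.trans ez)
    have hs : e' 0 = e 0 + 1 := by omega
    rw [hs] at ez
    exact step (e 0) y z h0.1 (by omega) hy hz ey ez
  by_cases hall : ∀ e ∈ S.codings x, e 0 = d 0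
  · obtain ⟨y, hy, ey, cy⟩ := S.coding_head hd
    obtain ⟨y', hy', ey', cy'⟩ := S.coding_head hd'
    have h0 := hd.1 0
    rw [hall d' hd'] at ey'
    have : y' = y := (S.f_mono h0.1 h0.2).injective (ey'.symm.trans ey)
    subst this
    cases n with
    | zero => exact absurd (hall d' hd').symm hn
    | succ n =>
      refine ih n (by omega) y' ?_ _ _ cy cy' hn
      rw [← S.encard_of_head h0.1 h0.2 (y := y'), ← ey, hx]
      rw [← ey]
      exact hall
  · push Not at hall
    obtain ⟨e, he, hne⟩ := hall
    rcases lt_or_gt_of_ne hne with h | h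
    · exact gen e he d hd h
    · exact gen d hd e he h

end ClassE

open ClassE

theorem stmt14 (S : ClassE) (hS : S.goodE)
    (h1 : S.f 1 '' S.I ∩ S.f 2 '' S.I = ∅)
    (h2 : S.f (S.m - 1) '' S.I ∩ S.f S.m '' S.I = ∅) :
    ∀ k : ℕ, 1 ≤ k → ¬ (∃ s : ℕ, k = 2 ^ s) → S.U k = ∅ := by
  intro k hk hnot
  rw [Set.eq_empty_iff_forall_notMem]
  rintro x ⟨-, hx⟩
  refine hnot (S.main hS h1 h2 k hk x ?_)
  rw [Set.encard, ENat.card, hx]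
  simp
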